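/- Every minimum consistent subset M of the reduction tree T contains exactly one vertex from every stabilizer pair {s_{i,j,1}, s_{i,j,2}}. Furthermore, within each variable gadget, all stabilizer vertices belonging to M are adjacent to one common vertex: either all of them are left stabilizers (adjacent to v_{i,1,1}) or all of them are right stabilizers (adjacent to v_{i,5,1}). -/

import Mathlib

/-- `C` is a consistent subset of the vertex-coloured graph `(G, col)`:
for every vertex `v ∉ C` there is `u ∈ C` of the same colour whose hop-distance
to `v` is minimum among all vertices of `C`. -/
def IsConsistent {V κ : Type*} (G : SimpleGraph V) (col : V → κ) (C : Set V) : Prop :=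
  ∀ v ∉ C, ∃ u ∈ C, col u = col v ∧ ∀ w ∈ C, G.dist v u ≤ G.dist v w

/-- `M` is a minimum consistent subset: a consistent subset of minimum cardinality. -/
def IsMinConsistent {V κ : Type*} (G : SimpleGraph V) (col : V → κ) (M : Set V) : Prop :=
  IsConsistent G col M ∧ ∀ C : Set V, IsConsistent G col C → M.ncard ≤ C.ncard

/-- A literal: a variable index together with a sign (`true` = positive). -/
abbrev Lit (n : ℕ) := Fin n × Bool

/-- The literal `l` is true under the assignment `a`. -/
def litTrue {n : ℕ} (a : Fin n → Bool) (l : Lit n) : Bool := a l.1 == l.2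

/-- The number of clauses of the 2-CNF formula `θ` satisfied by the assignment `a`
(a clause is satisfied if at least one of its two literals is true). -/
def satCount {n m : ℕ} (θ : Fin m → Lit n × Lit n) (a : Fin n → Bool) : ℕ :=
  (Finset.univ.filter fun j : Fin m =>
    (litTrue a (θ j).1 || litTrue a (θ j).2) = true).card

/-- The vertices of the reduction tree `T` for a 2-CNF formula with `n` variables
and `m` clauses:
* `lit i s q`  : the `(q+1)`-st vertex of the positive (`s = true`) or negative
  (`s = false`) literal path of the variable gadget of `x i`;
* `varp i j q` : the `(q+1)`-st vertex of the `(j+1)`-st variable path of `x i`;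
* `stab i j s` : the left (`s = false`) or right (`s = true`) stabilizer of the
  `(j+1)`-st stabilizer pair of `x i`;
* `cl j q`     : the `(q+1)`-st vertex of the clause path of clause `j`;
* `occ j s q`  : the `(q+1)`-st vertex of the left (`s = false`) or right
  (`s = true`) occurrence path of clause `j`;
* `chain none` : the central chain vertex `p₀`; `chain (some (j, r))` : the
  `(r+1)`-st of the three chain vertices joining `p₀` to clause `j`;
* `ext c q`    : the `(q+1)`-st of the seven extra vertices of the chain path
  attached to the chain vertex `chain c`. -/
inductive TVert (n m : ℕ) : Type where
  | lit   : Fin n → Bool → Fin 5 → TVert n m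
  | varp  : Fin n → Fin 5 → Fin 6 → TVert n m
  | stab  : Fin n → Fin (m * n) → Bool → TVert n m
  | cl    : Fin m → Fin 17 → TVert n m
  | occ   : Fin m → Bool → Fin 2 → TVert n m
  | chain : Option (Fin m × Fin 3) → TVert n m
  | ext   : Option (Fin m × Fin 3) → Fin 7 → TVert n m
deriving DecidableEq

/-- The base (one-directional) adjacency relation of the reduction tree. -/
inductive TAdj (n m : ℕ) : TVert n m → TVert n m → Prop where
  | litPath (i : Fin n) (s : Bool) (a b : Fin 5) (h : (a : ℕ) + 1 = b) :
      TAdj n m (.lit i s a) (.lit i s b)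
  | varPath (i : Fin n) (j : Fin 5) (a b : Fin 6) (h : (a : ℕ) + 1 = b) :
      TAdj n m (.varp i j a) (.varp i j b)
  | varSpine (i : Fin n) (j j' : Fin 5) (h : (j : ℕ) + 1 = j') :
      TAdj n m (.varp i j 0) (.varp i j' 0)
  | stabLeft (i : Fin n) (j : Fin (m * n)) :
      TAdj n m (.stab i j false) (.varp i 0 0)
  | stabRight (i : Fin n) (j : Fin (m * n)) :
      TAdj n m (.stab i j true) (.varp i 4 0)
  | litPos (i : Fin n) : TAdj n m (.lit i true 0) (.varp i 0 0)
  | litNeg (i : Fin n) : TAdj n m (.lit i false 0) (.varp i 4 0)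
  | clPath (j : Fin m) (a b : Fin 17) (h : (a : ℕ) + 1 = b) :
      TAdj n m (.cl j a) (.cl j b)
  | occPath (j : Fin m) (s : Bool) : TAdj n m (.occ j s 0) (.occ j s 1)
  | occLeft (j : Fin m) : TAdj n m (.occ j false 0) (.cl j 1)
  | occRight (j : Fin m) : TAdj n m (.occ j true 0) (.cl j 15)
  | centerVar (i : Fin n) : TAdj n m (.chain none) (.varp i 2 0)
  | chainStart (j : Fin m) : TAdj n m (.chain none) (.chain (some (j, 0)))
  | chainStep (j : Fin m) (r r' : Fin 3) (h : (r : ℕ) + 1 = r') :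
      TAdj n m (.chain (some (j, r))) (.chain (some (j, r')))
  | chainClause (j : Fin m) : TAdj n m (.chain (some (j, 2))) (.cl j 8)
  | extAttach (c : Option (Fin m × Fin 3)) : TAdj n m (.chain c) (.ext c 0)
  | extPath (c : Option (Fin m × Fin 3)) (a b : Fin 7) (h : (a : ℕ) + 1 = b) :
      TAdj n m (.ext c a) (.ext c b)

/-- The reduction tree `T`, as a simple graph. -/
def redTree (n m : ℕ) : SimpleGraph (TVert n m) := SimpleGraph.fromRel (TAdj n m)

/-- The colours of the reduction tree: one for each literal path (shared by the
corresponding occurrence paths), one for each variable path, one for each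
stabilizer pair, one for each clause path, and one for each chain path. -/
inductive TCol (n m : ℕ) : Type where
  | litC  : Fin n → Bool → TCol n m
  | varC  : Fin n → Fin 5 → TCol n m
  | stabC : Fin n → Fin (m * n) → TCol n m
  | clC   : Fin m → TCol n m
  | chC   : Option (Fin m × Fin 3) → TCol n m
deriving DecidableEq

/-- The colouring of the reduction tree determined by the 2-CNF formula `θ`:
each occurrence path gets the colour of the literal path of its literal, and
every other path (and each stabilizer pair) gets its own distinct colour; each
chain vertex shares the colour of its attached chain path. -/
def tcol {n m : ℕ} (θ : Fin m → Lit n × Lit n) : TVert n m → TCol n m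
  | .lit i s _  => .litC i s
  | .varp i j _ => .varC i j
  | .stab i j _ => .stabC i j
  | .cl j _     => .clC j
  | .occ j s _  => if s then .litC (θ j).2.1 (θ j).2.2 else .litC (θ j).1.1 (θ j).1.2
  | .chain c    => .chC c
  | .ext c _    => .chC c

namespace SimpleGraph

variable {V : Type*} {G : SimpleGraph V}

/-- A natural-valued function that drops by at most one along each edge, and vanishes at `w`,
is bounded by the distance to `w`. -/
lemma Connected.le_dist_of_lipschitz (hG : G.Connected) {f : V → ℕ}
    (hf : ∀ u v, G.Adj u v → f u ≤ f v + 1) {v w : V} (hw : f w = 0) : f v ≤ G.dist v w := by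
  obtain ⟨p, hp⟩ := hG.exists_walk_length_eq_dist v w
  rw [← hp]
  clear hp
  induction p with
  | nil => simp [hw]
  | cons h p ih =>
    have := hf _ _ h
    have := ih hw
    simp only [Walk.length_cons]
    omega

end SimpleGraph

namespace TVert

variable {n m : ℕ}

instance : Finite (TVert n m) := by
  let e : (Fin n × Bool × Fin 5) ⊕ (Fin n × Fin 5 × Fin 6) ⊕ (Fin n × Fin (m * n) × Bool) ⊕
      (Fin m × Fin 17) ⊕ (Fin m × Bool × Fin 2) ⊕ Option (Fin m × Fin 3) ⊕
      (Option (Fin m × Fin 3) × Fin 7) → TVert n m :=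
    Sum.elim (fun x => lit x.1 x.2.1 x.2.2) <| Sum.elim (fun x => varp x.1 x.2.1 x.2.2) <|
      Sum.elim (fun x => stab x.1 x.2.1 x.2.2) <| Sum.elim (fun x => cl x.1 x.2) <|
      Sum.elim (fun x => occ x.1 x.2.1 x.2.2) <| Sum.elim chain (fun x => ext x.1 x.2)
  refine Finite.of_surjective e ?_
  rintro (⟨i, s, q⟩ | ⟨i, j, q⟩ | ⟨i, j, s⟩ | ⟨j, q⟩ | ⟨j, s, q⟩ | c | ⟨c, q⟩)
  · exact ⟨.inl (i, s, q), rfl⟩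
  · exact ⟨.inr (.inl (i, j, q)), rfl⟩
  · exact ⟨.inr (.inr (.inl (i, j, s))), rfl⟩
  · exact ⟨.inr (.inr (.inr (.inl (j, q)))), rfl⟩
  · exact ⟨.inr (.inr (.inr (.inr (.inl (j, s, q))))), rfl⟩
  · exact ⟨.inr (.inr (.inr (.inr (.inr (.inl c))))), rfl⟩
  · exact ⟨.inr (.inr (.inr (.inr (.inr (.inr (c, q)))))), rfl⟩

/-- The distance of a vertex to the set of zeros of this function, which is a consistent subset
made up of all left stabilizers, all clause and occurrence paths, and one vertex of each other path. -/
def depth : TVert n m → ℕ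
  | lit _ true q => q
  | lit _ false q => 4 - q
  | varp _ j q => (q - (j + 1)) + (j + 1 - q)
  | stab _ _ false => 0
  | stab _ _ true => 6
  | cl _ _ => 0
  | occ _ _ _ => 0
  | chain none => 4
  | chain (some (_, r)) => 3 - r
  | ext none q => (q - 3) + (3 - q)
  | ext (some (_, r)) q => (q - (2 - r)) + (2 - r - q)

end TVert

section redTree

open TVert

variable {n m : ℕ}

lemma TAdj.ne {u v : TVert n m} (h : TAdj n m u v) : u ≠ v := by
  cases h <;> simp [Fin.ext_iff] <;> omega

lemma TAdj.redTree_adj {u v : TVert n m} (h : TAdj n m u v) : (redTree n m).Adj u v :=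
  (SimpleGraph.fromRel_adj _ _ _).2 ⟨h.ne, .inl h⟩

lemma TAdj.depth_le {u v : TVert n m} (h : TAdj n m u v) :
    depth u ≤ depth v + 1 ∧ depth v ≤ depth u + 1 := by
  cases h with
  | litPath i s a b h => cases s <;> simp only [depth] <;> omega
  | extPath c a b h => rcases c with _ | ⟨j, r⟩ <;> simp only [depth] <;> omega
  | extAttach c =>
    rcases c with _ | ⟨j, r⟩ <;> simp only [depth, Fin.val_zero] <;> omega
  | _ => simp [depth] <;> omega

lemma redTree_depth_le {u v : TVert n m} (h : (redTree n m).Adj u v) :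
    depth u ≤ depth v + 1 := by
  rcases ((SimpleGraph.fromRel_adj _ _ _).1 h).2 with h | h
  · exact h.depth_le.1
  · exact h.depth_le.2

lemma redTree_reachable_of_path {k : ℕ} (f : Fin (k + 1) → TVert n m)
    (hf : ∀ a b : Fin (k + 1), (a : ℕ) + 1 = b → TAdj n m (f a) (f b)) (a b : Fin (k + 1)) :
    (redTree n m).Reachable (f a) (f b) := by
  have key (a : Fin (k + 1)) : (redTree n m).Reachable (f 0) (f a) := by
    induction a using Fin.induction with
    | zero => rfl
    | succ a ih => exact ih.trans (hf a.castSucc a.succ (by simp)).redTree_adj.reachable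
  exact (key a).symm.trans (key b)

lemma redTree_reachable_center (v : TVert n m) :
    (redTree n m).Reachable v (chain none) := by
  have hvar (i j q) : (redTree n m).Reachable (varp i j q) (chain none) :=
    (redTree_reachable_of_path _ (TAdj.varPath i j) q 0).trans <|
      (redTree_reachable_of_path (fun j => varp i j 0) (TAdj.varSpine i) j 2).trans
        (TAdj.centerVar i).redTree_adj.symm.reachable
  have hchain (c) : (redTree n m).Reachable (chain c) (chain none) := by
    rcases c with _ | ⟨j, r⟩
    · rfl
    · exact (redTree_reachable_of_path (fun r => chain (some (j, r))) (TAdj.chainStep j) r 0).trans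
        (TAdj.chainStart j).redTree_adj.symm.reachable
  have hcl (j q) : (redTree n m).Reachable (cl j q) (chain none) :=
    (redTree_reachable_of_path _ (TAdj.clPath j) q 8).trans <|
      (TAdj.chainClause j).redTree_adj.symm.reachable.trans (hchain _)
  have hocc (j s) : (redTree n m).Reachable (occ j s 0) (chain none) := by
    cases s
    · exact (TAdj.occLeft j).redTree_adj.reachable.trans (hcl _ _)
    · exact (TAdj.occRight j).redTree_adj.reachable.trans (hcl _ _)
  rcases v with ⟨i, s, q⟩ | ⟨i, j, q⟩ | ⟨i, j, s⟩ | ⟨j, q⟩ | ⟨j, s, q⟩ | c | ⟨c, q⟩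
  · refine (redTree_reachable_of_path _ (TAdj.litPath i s) q 0).trans ?_
    cases s
    · exact (TAdj.litNeg i).redTree_adj.reachable.trans (hvar _ _ _)
    · exact (TAdj.litPos i).redTree_adj.reachable.trans (hvar _ _ _)
  · exact hvar i j q
  · cases s
    · exact (TAdj.stabLeft i j).redTree_adj.reachable.trans (hvar _ _ _)
    · exact (TAdj.stabRight i j).redTree_adj.reachable.trans (hvar _ _ _)
  · exact hcl j q
  · refine SimpleGraph.Reachable.trans ?_ (hocc j s)
    fin_cases q
    · rfl
    · exact (TAdj.occPath j s).redTree_adj.symm.reachable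
  · exact hchain c
  · exact (redTree_reachable_of_path _ (TAdj.extPath c) q 0).trans <|
      (TAdj.extAttach c).redTree_adj.symm.reachable.trans (hchain c)

lemma redTree_connected : (redTree n m).Connected where
  preconnected u v := (redTree_reachable_center u).trans (redTree_reachable_center v).symm
  nonempty := ⟨chain none⟩

lemma six_le_dist_stab (i : Fin n) (j : Fin (m * n)) (b : Bool) :
    6 ≤ (redTree n m).dist (stab i j b) (stab i j !b) := by
  have key : 6 ≤ (redTree n m).dist (stab i j true) (stab i j false) :=
    redTree_connected.le_dist_of_lipschitz (f := depth) (v := stab i j true)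
      (w := stab i j false) (fun _ _ => redTree_depth_le) rfl
  cases b
  · rwa [SimpleGraph.dist_comm]
  · exact key

lemma dist_stab_le_two (i : Fin n) (j j' : Fin (m * n)) (b : Bool) :
    (redTree n m).dist (stab i j b) (stab i j' b) ≤ 2 := by
  cases b
  · exact SimpleGraph.dist_le (.cons (TAdj.stabLeft i j).redTree_adj
      (TAdj.stabLeft i j').redTree_adj.symm.toWalk)
  · exact SimpleGraph.dist_le (.cons (TAdj.stabRight i j).redTree_adj
      (TAdj.stabRight i j').redTree_adj.symm.toWalk)

lemma dist_stab_le_six (i : Fin n) (j : Fin (m * n)) :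
    (redTree n m).dist (stab i j true) (stab i j false) ≤ 6 :=
  SimpleGraph.dist_le (.cons (TAdj.stabRight i j).redTree_adj <|
    .cons (TAdj.varSpine i 3 4 rfl).redTree_adj.symm <|
    .cons (TAdj.varSpine i 2 3 rfl).redTree_adj.symm <|
    .cons (TAdj.varSpine i 1 2 rfl).redTree_adj.symm <|
    .cons (TAdj.varSpine i 0 1 rfl).redTree_adj.symm
      (TAdj.stabLeft i j).redTree_adj.symm.toWalk)

lemma redTree_dist_path_le {k : ℕ} (f : Fin (k + 1) → TVert n m)
    (hf : ∀ a b : Fin (k + 1), (a : ℕ) + 1 = b → TAdj n m (f a) (f b)) (a b : Fin (k + 1)) :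
    (redTree n m).dist (f a) (f b) ≤ ((a : ℕ) - b) + (b - a) := by
  have key (d : ℕ) : ∀ a b : Fin (k + 1), (a : ℕ) + d = b →
      (redTree n m).dist (f a) (f b) ≤ d := by
    induction d with
    | zero =>
      intro a b h
      obtain rfl : a = b := Fin.ext (by omega)
      simp
    | succ d ih =>
      intro a b h
      have h1 := ih a ⟨a + d, by omega⟩ rfl
      have h2 := SimpleGraph.dist_eq_one_iff_adj.2
        (hf ⟨a + d, by omega⟩ b (by simp only; omega)).redTree_adj
      exact (redTree_connected.dist_triangle (v := f ⟨a + d, by omega⟩)).trans (by omega)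
  rcases le_total (a : ℕ) b with h | h
  · exact (key (b - a) a b (by omega)).trans (by omega)
  · rw [SimpleGraph.dist_comm]
    exact (key (a - b) b a (by omega)).trans (by omega)

lemma redTree_dist_chain_ext_le (c : Option (Fin m × Fin 3)) (q : Fin 7) :
    (redTree n m).dist (chain c) (ext c q) ≤ q + 1 := by
  have h1 := SimpleGraph.dist_eq_one_iff_adj.2 (TAdj.extAttach (n := n) c).redTree_adj
  have h2 := redTree_dist_path_le _ (TAdj.extPath (n := n) c) 0 q
  simp only [Fin.val_zero] at h2
  exact (redTree_connected.dist_triangle (v := ext c 0)).trans (by omega)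

lemma exists_depth_zero_dist_le (θ : Fin m → Lit n × Lit n) (v : TVert n m) :
    ∃ u, depth u = 0 ∧ tcol θ u = tcol θ v ∧ (redTree n m).dist v u ≤ depth v := by
  rcases v with ⟨i, _ | _, q⟩ | ⟨i, j, q⟩ | ⟨i, j, _ | _⟩ | ⟨j, q⟩ | ⟨j, s, q⟩ | (_ | ⟨j, r⟩) |
    ⟨_ | ⟨j, r⟩, q⟩
  · refine ⟨lit i false 4, rfl, rfl, (redTree_dist_path_le _ (TAdj.litPath i _) q 4).trans ?_⟩
    simp only [depth]
    change (q : ℕ) - 4 + (4 - q) ≤ _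
    omega
  · refine ⟨lit i true 0, rfl, rfl, (redTree_dist_path_le _ (TAdj.litPath i _) q 0).trans ?_⟩
    simp [depth]
  · refine ⟨varp i j j.succ, ?_, rfl,
      (redTree_dist_path_le _ (TAdj.varPath i j) q j.succ).trans ?_⟩ <;>
    simp [depth]
  · exact ⟨_, rfl, rfl, by simp⟩
  · exact ⟨stab i j false, rfl, rfl, dist_stab_le_six i j⟩
  · exact ⟨_, rfl, rfl, by simp⟩
  · exact ⟨_, rfl, rfl, by simp⟩
  · exact ⟨ext none 3, rfl, rfl, redTree_dist_chain_ext_le none 3⟩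
  · refine ⟨ext (some (j, r)) ⟨2 - r, by omega⟩, by simp [depth], rfl,
      (redTree_dist_chain_ext_le _ _).trans ?_⟩
    simp only [depth]
    omega
  · exact ⟨ext none 3, rfl, rfl, redTree_dist_path_le _ (TAdj.extPath none) q 3⟩
  · exact ⟨ext (some (j, r)) ⟨2 - r, by omega⟩, by simp [depth], rfl,
      redTree_dist_path_le _ (TAdj.extPath _) q ⟨2 - r, by omega⟩⟩

lemma isConsistent_depth_zero (θ : Fin m → Lit n × Lit n) :
    IsConsistent (redTree n m) (tcol θ) {v | depth v = 0} := by
  intro v _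
  obtain ⟨u, hu, hcol, hd⟩ := exists_depth_zero_dist_le θ v
  exact ⟨u, hu, hcol, fun w hw => hd.trans <|
    redTree_connected.le_dist_of_lipschitz (fun _ _ => redTree_depth_le) hw⟩

lemma ncard_depth_zero_le :
    {v : TVert n m | depth v = 0}.ncard ≤ n * (m * n) + 7 * n + 24 * m + 1 := by
  let e : (Fin n × Fin (m * n)) ⊕ (Fin n × (Bool ⊕ Fin 5)) ⊕
      (Fin m × (Fin 17 ⊕ (Bool × Fin 2) ⊕ Fin 3)) ⊕ Unit → TVert n m :=
    Sum.elim (fun x => stab x.1 x.2 false) <|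
      Sum.elim (fun x => x.2.elim (fun s => lit x.1 s (if s then 0 else 4))
        (fun j => varp x.1 j j.succ)) <|
      Sum.elim (fun x => x.2.elim (fun q => cl x.1 q) (Sum.elim (fun y => occ x.1 y.1 y.2)
        (fun r => ext (some (x.1, r)) ⟨2 - r, by omega⟩))) (fun _ => ext none 3)
  have hsub : {v : TVert n m | depth v = 0} ⊆ Set.range e := by
    rintro (⟨i, _ | _, q⟩ | ⟨i, j, q⟩ | ⟨i, j, _ | _⟩ | ⟨j, q⟩ | ⟨j, s, q⟩ | (_ | ⟨j, r⟩) |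
      ⟨_ | ⟨j, r⟩, q⟩) h <;> simp only [depth, Set.mem_ofPred_eq] at h
    · obtain rfl : q = 4 := Fin.ext (by change (q : ℕ) = 4; omega)
      exact ⟨.inr (.inl (i, .inl false)), rfl⟩
    · obtain rfl : q = 0 := Fin.ext h
      exact ⟨.inr (.inl (i, .inl true)), rfl⟩
    · obtain rfl : q = j.succ := Fin.ext (by simp only [Fin.val_succ]; omega)
      exact ⟨.inr (.inl (i, .inr j)), rfl⟩
    · exact ⟨.inl (i, j), rfl⟩
    · omega
    · exact ⟨.inr (.inr (.inl (j, .inl q))), rfl⟩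
    · exact ⟨.inr (.inr (.inl (j, .inr (.inl (s, q))))), rfl⟩
    · omega
    · omega
    · obtain rfl : q = 3 := Fin.ext (by change (q : ℕ) = 3; omega)
      exact ⟨.inr (.inr (.inr ())), rfl⟩
    · exact ⟨.inr (.inr (.inl (j, .inr (.inr r)))),
        congrArg (ext _) (Fin.ext (by change 2 - (r : ℕ) = q; omega))⟩
  calc {v : TVert n m | depth v = 0}.ncard ≤ (Set.range e).ncard :=
        Set.ncard_le_ncard hsub (Set.toFinite _)
    _ ≤ Nat.card _ := by
        rw [← Set.image_univ, ← Set.ncard_univ]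
        exact Set.ncard_image_le (Set.toFinite _)
    _ = n * (m * n) + 7 * n + 24 * m + 1 := by
        simp only [Nat.card_eq_fintype_card, Fintype.card_sum, Fintype.card_prod,
          Fintype.card_fin, Fintype.card_bool, Fintype.card_unit]
        ring

lemma tcol_eq_stabC {θ : Fin m → Lit n × Lit n} {u : TVert n m} {i : Fin n} {j : Fin (m * n)}
    (h : tcol θ u = .stabC i j) : ∃ b, u = stab i j b := by
  rcases u with ⟨i, s, q⟩ | ⟨i, j, q⟩ | ⟨i, j, s⟩ | ⟨j, q⟩ | ⟨j, _ | _, q⟩ | c | ⟨c, q⟩ <;>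
    simp_all [tcol]

namespace IsConsistent

variable {θ : Fin m → Lit n × Lit n} {C : Set (TVert n m)}

lemma stab_mem (hC : IsConsistent (redTree n m) (tcol θ) C) {i : Fin n} {j : Fin (m * n)}
    {b : Bool} (h : stab i j b ∉ C) : (stab i j !b) ∈ C := by
  obtain ⟨u, hu, hcol, -⟩ := hC _ h
  obtain ⟨b', rfl⟩ := tcol_eq_stabC hcol
  obtain rfl | rfl : b' = b ∨ b' = !b := by cases b <;> cases b' <;> simp
  · exact absurd hu h
  · exact hu

lemma stab_notMem (hC : IsConsistent (redTree n m) (tcol θ) C) {i : Fin n} {j : Fin (m * n)}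
    {b : Bool} (h : stab i j b ∉ C) (j' : Fin (m * n)) : stab i j' b ∉ C := by
  intro hj'
  obtain ⟨u, hu, hcol, hmin⟩ := hC _ h
  obtain ⟨b', rfl⟩ := tcol_eq_stabC hcol
  obtain rfl | rfl : b' = b ∨ b' = !b := by cases b <;> cases b' <;> simp
  · exact h hu
  · have := hmin _ hj'
    have := six_le_dist_stab i j b
    have := dist_stab_le_two i j j' b
    omega

lemma le_ncard (hC : IsConsistent (redTree n m) (tcol θ) C) {i : Fin n}
    (h : ∀ j b, stab i j b ∈ C) : n * (m * n) + m * n ≤ C.ncard := by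
  have hex (x : Fin n × Fin (m * n)) : ∃ b, stab x.1 x.2 b ∈ C ∧ (x.1 = i → b = false) := by
    by_cases hx : x.1 = i
    · exact ⟨false, hx ▸ h _ _, fun _ => rfl⟩
    · by_cases hb : stab x.1 x.2 false ∈ C
      · exact ⟨false, hb, fun _ => rfl⟩
      · exact ⟨true, hC.stab_mem hb, fun h => absurd h hx⟩
  choose f hfC hf using hex
  let e : (Fin n × Fin (m * n)) ⊕ Fin (m * n) → C :=
    Sum.elim (fun x => ⟨stab x.1 x.2 (f x), hfC x⟩) (fun j => ⟨stab i j true, h j true⟩)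
  have he : Function.Injective e := by
    rintro (⟨a, b⟩ | b) (⟨a', b'⟩ | b') hab <;>
      simp only [e, Sum.elim_inl, Sum.elim_inr, Subtype.mk.injEq, stab.injEq] at hab
    · rw [hab.1, hab.2.1]
    · simp [hf (a, b) hab.1] at hab
    · simp [hf (a', b') hab.1.symm] at hab
    · rw [hab.2.1]
  have := Nat.card_le_card_of_injective e he
  simpa [Nat.card_coe_set_eq] using this

end IsConsistent

end redTree

/-- Every minimum consistent subset `M` of the reduction tree contains exactly one
vertex from every stabilizer pair; moreover, within each variable gadget all the
stabilizers belonging to `M` lie on a common side (all left, or all right), i.e.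
they are all adjacent to one common vertex of a variable path. -/
theorem stabilizers_in_minimum_consistent_subset
    (n m : ℕ) (hn : 50 ≤ n) (hm : 50 ≤ m)
    (θ : Fin m → Lit n × Lit n)
    (M : Set (TVert n m)) (hM : IsMinConsistent (redTree n m) (tcol θ) M) :
    (∀ (i : Fin n) (j : Fin (m * n)),
        (TVert.stab i j false ∈ M ∧ TVert.stab i j true ∉ M) ∨
        (TVert.stab i j true ∈ M ∧ TVert.stab i j false ∉ M)) ∧
    (∀ i : Fin n, ∃ s : Bool, ∀ (j : Fin (m * n)) (b : Bool),
        TVert.stab i j b ∈ M → b = s) := by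
  obtain ⟨hC, hmin⟩ := hM
  have key (i : Fin n) : ∃ b, ∀ j, TVert.stab i j b ∈ M ∧ TVert.stab i j (!b) ∉ M := by
    obtain ⟨j, b, hb⟩ : ∃ j b, TVert.stab i j b ∉ M := by
      by_contra! h
      have h1 := (hC.le_ncard h).trans (hmin _ (isConsistent_depth_zero θ))
      have h2 := h1.trans ncard_depth_zero_le
      nlinarith
    exact ⟨!b, fun j' => ⟨hC.stab_mem (hC.stab_notMem hb j'),
      by simpa using hC.stab_notMem hb j'⟩⟩
  choose s hs using key
  refine ⟨fun i j => ?_, fun i => ⟨s i, fun j b hb => ?_⟩⟩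
  · have := hs i j
    cases h : s i <;> simp_all
  · have := (hs i j).2
    by_contra hne
    exact this (Bool.eq_not.2 hne ▸ hb)
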